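/- Fix n ≥ 2 and let Q ⊆ R be such that the action of t confines R into Q. Then there exists N ∈ ℕ such that, in the lamplighter group L_n, every element of B₊ is a product of at most N elements of S ∪ S⁻¹, where S = Q ∪ {t, t⁻¹}. (That is, B₊ is uniformly bounded in the word metric on L_n associated with the generating set Q ∪ {t, t⁻¹}.) -/

import Mathlib

open Function Set Pointwise

/-- The base `A = ⊕_{i∈ℤ} ℤ_n` of the lamplighter group, identified with the additive
group of the Laurent polynomial ring `R = ℤ_n[t, t⁻¹]` (a Laurent polynomial is its
finitely supported coefficient function `ℤ →₀ ℤ_n`). -/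
abbrev Rn (n : ℕ) := ℤ →₀ ZMod n

/-- Multiplication by `t^m` on `R = ℤ_n[t, t⁻¹]`: the coefficient of `t^j` in `t^m·p`
is the coefficient of `t^{j−m}` in `p`. -/
def tmul (n : ℕ) (m : ℤ) : Rn n ≃+ Rn n :=
  Finsupp.domCongr (Equiv.addRight m)

/-- `B₊`: the set of Laurent polynomials all of whose exponents are `≥ 0`. -/
def Bplus (n : ℕ) : Set (Rn n) := {p | ∀ i : ℤ, i < 0 → p i = 0}

/-- The action of `t` confines `R` into `Q`: (a) `tQ ⊆ Q`; (b) every `p ∈ R` has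
`t^m p ∈ Q` for some `m ≥ 0`; (c) `t^{n₀}(Q + Q) ⊆ Q` for some `n₀ ≥ 0`. -/
def ConfinesT (n : ℕ) (Q : Set (Rn n)) : Prop :=
  (∀ q ∈ Q, tmul n 1 q ∈ Q) ∧
  (∀ p : Rn n, ∃ m : ℕ, tmul n m p ∈ Q) ∧
  (∃ n₀ : ℕ, ∀ q₁ ∈ Q, ∀ q₂ ∈ Q, tmul n n₀ (q₁ + q₂) ∈ Q)

/-- Strictly confining: moreover `tQ` is a proper subset of `Q`. -/
def StrictlyConfinesT (n : ℕ) (Q : Set (Rn n)) : Prop :=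
  ConfinesT n Q ∧ ⇑(tmul n 1) '' Q ⊂ Q

/-- The lamplighter group `L_n = ℤ_n wr ℤ = (⊕_{ℤ} ℤ_n) ⋊ ℤ`, where the generator `t`
of `ℤ` acts on the base by the shift (= multiplication by `t`). -/
abbrev Ln (n : ℕ) := SemidirectProduct (Multiplicative (Rn n)) (Multiplicative ℤ)
  (zpowersHom (MulAut (Multiplicative (Rn n))) (AddEquiv.toMultiplicative (tmul n 1)))

/-- The element `t` of the lamplighter group. -/
noncomputable def tL (n : ℕ) : Ln n := SemidirectProduct.inr (Multiplicative.ofAdd (1 : ℤ))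

/-- The embedding of the base `A = R` into the lamplighter group. -/
noncomputable def ι (n : ℕ) (p : Rn n) : Ln n := SemidirectProduct.inl (Multiplicative.ofAdd p)

/-- the generating set `S = Q ∪ {t, t⁻¹}` of `L_n` associated with `Q ⊆ R`. -/
def Sgen (n : ℕ) (Q : Set (Rn n)) : Set (Ln n) :=
  (ι n '' Q) ∪ {tL n, (tL n)⁻¹}

/-- products of at most `N` elements of `S ∪ S⁻¹`. -/
def wordBall {W : Type*} [Group W] (S : Set W) (N : ℕ) : Set W :=
  {w | ∃ l : List W, l.length ≤ N ∧ (∀ x ∈ l, x ∈ S ∪ S⁻¹) ∧ l.prod = w}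

theorem aux_tmul_apply (n : ℕ) (m : ℤ) (p : Rn n) (i : ℤ) : tmul n m p i = p (i - m) := by
  simp [tmul, sub_eq_add_neg]

theorem aux_tmul_tmul (n : ℕ) (a b : ℤ) (p : Rn n) :
    tmul n a (tmul n b p) = tmul n (a + b) p := by
  ext i
  simp only [aux_tmul_apply]
  congr 1
  ring

theorem aux_conj (n : ℕ) (p : Rn n) : ι n p = (tL n)⁻¹ * ι n (tmul n 1 p) * tL n := by
  have h : ι n (tmul n 1 p) = tL n * ι n p * (tL n)⁻¹ := by
    unfold ι tL
    have := SemidirectProduct.inl_aut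
      (φ := zpowersHom (MulAut (Multiplicative (Rn n))) (AddEquiv.toMultiplicative (tmul n 1)))
      (Multiplicative.ofAdd (1 : ℤ)) (Multiplicative.ofAdd p)
    rw [map_inv] at this
    rw [← this]
    simp [zpowersHom_apply]
  rw [h]
  group

theorem aux_word (n : ℕ) (Q : Set (Rn n)) (M : ℕ) : ∀ p : Rn n, tmul n M p ∈ Q →
    ι n p ∈ wordBall (Sgen n Q) (2 * M + 1) := by
  induction M with
  | zero =>
    intro p hp
    have h0 : tmul n ((0 : ℕ) : ℤ) p = p := by ext i; simp [aux_tmul_apply]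
    rw [h0] at hp
    exact ⟨[ι n p], by simp, by
      intro x hx
      rw [List.mem_singleton] at hx
      subst hx
      exact Or.inl (Or.inl ⟨p, hp, rfl⟩), by simp⟩
  | succ M ih =>
    intro p hp
    obtain ⟨l, hl, hS, hprod⟩ := ih (tmul n 1 p) (by
      rw [aux_tmul_tmul]; exact_mod_cast hp)
    refine ⟨(tL n)⁻¹ :: (l ++ [tL n]), ?_, ?_, ?_⟩
    · simp; omega
    · intro x hx
      simp only [List.mem_cons, List.mem_append, List.not_mem_nil, or_false] at hx
      rcases hx with rfl | hx | rfl
      · exact Or.inl (Or.inr (by simp))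
      · exact hS x hx
      · exact Or.inl (Or.inr (by simp))
    · rw [aux_conj n p, ← hprod]
      simp [mul_assoc]

theorem aux_up (n : ℕ) (Q : Set (Rn n)) (h : ∀ q ∈ Q, tmul n 1 q ∈ Q) (k : ℕ) :
    ∀ q ∈ Q, tmul n k q ∈ Q := by
  induction k with
  | zero =>
    intro q hq
    have h0 : tmul n ((0 : ℕ) : ℤ) q = q := by ext i; simp [aux_tmul_apply]
    rwa [h0]
  | succ k ih =>
    intro q hq
    have := h _ (ih q hq)
    rw [aux_tmul_tmul, add_comm] at this
    exact_mod_cast this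

/-- If the action of `t` confines `R` into `Q`, then `B₊` is uniformly
bounded in the word metric on `L_n` associated with the generating set `Q ∪ {t, t⁻¹}`. -/
theorem Bplus_bounded_in_Q_metric (n : ℕ) (hn : 2 ≤ n) (Q : Set (Rn n))
    (hQ : ConfinesT n Q) :
    ∃ N : ℕ, ∀ p ∈ Bplus n, ι n p ∈ wordBall (Sgen n Q) N := by
  obtain ⟨h1, h2, n₀, h3⟩ := hQ
  have : NeZero n := ⟨by omega⟩
  have hup := aux_up n Q h1
  obtain ⟨c, hc, hadd⟩ : ∃ c : ℕ, 0 < c ∧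
      ∀ q₁ ∈ Q, ∀ q₂ ∈ Q, tmul n c (q₁ + q₂) ∈ Q := by
    refine ⟨n₀ + 1, by omega, fun q₁ hq₁ q₂ hq₂ => ?_⟩
    have := h1 _ (h3 q₁ hq₁ q₂ hq₂)
    rw [aux_tmul_tmul, add_comm] at this
    exact_mod_cast this
  choose m hm using h2
  let F : Finset (Rn n) := (Finset.Ico (0 : ℤ) c).finsupp (fun _ => Finset.univ)
  have hF : ∀ f : Rn n, (∀ i, i < 0 ∨ (c : ℤ) ≤ i → f i = 0) → tmul n (F.sup m : ℕ) f ∈ Q := by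
    intro f hf
    have hfF : f ∈ F := by
      rw [Finset.mem_finsupp_iff]
      refine ⟨fun i hi => ?_, fun _ _ => Finset.mem_univ _⟩
      rw [Finsupp.mem_support_iff] at hi
      rw [Finset.mem_Ico]
      by_contra hcon
      exact hi (hf i (by omega))
    have hle : m f ≤ F.sup m := Finset.le_sup hfF
    have := hup (F.sup m - m f) _ (hm f)
    rw [aux_tmul_tmul] at this
    have e : ((F.sup m - m f : ℕ) : ℤ) + (m f : ℤ) = (F.sup m : ℕ) := by omega
    rwa [e] at this
  generalize F.sup m = k at hF
  have key : ∀ d : ℕ, ∀ p : Rn n, (∀ i, i < 0 ∨ (d : ℤ) * c ≤ i → p i = 0) →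
      tmul n ((c + k : ℕ) : ℤ) p ∈ Q := by
    intro d
    induction d with
    | zero =>
      intro p hp
      have hp0 : p = 0 := by
        ext i
        exact hp i (by push_cast; rw [zero_mul]; omega)
      have := hup c _ (hF 0 (by simp))
      rw [hp0]
      simpa using this
    | succ d ih =>
      intro p hp
      let f : Rn n := p.filter (fun i => i < c)
      let g : Rn n := tmul n (-c) (p.filter (fun i => ¬ i < c))
      have hf := hF f (by
        intro i hi
        simp only [f, Finsupp.filter_apply]
        split_ifs with h
        · exact hp i (by omega)
        · rfl)
      have hg := ih g (by
        intro i hi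
        simp only [g, aux_tmul_apply, Finsupp.filter_apply]
        split_ifs with h
        · rfl
        · apply hp
          push_cast
          rw [add_mul, one_mul]
          omega)
      have e : tmul n ((c + k : ℕ) : ℤ) p =
          tmul n c (tmul n k f + tmul n ((c + k : ℕ) : ℤ) g) := by
        have hp2 : p = f + p.filter (fun i : ℤ => ¬ i < (c : ℤ)) :=
          (Finsupp.filter_add_filter_not p _).symm
        rw [map_add]
        simp only [g, aux_tmul_tmul]
        conv_lhs => rw [hp2, map_add]
        congr 3
        push_cast
        ring
      rw [e]
      exact hadd _ hf _ hg
  refine ⟨2 * (c + k) + 1, fun p hp => aux_word n Q (c + k) p ?_⟩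
  obtain ⟨b, hb⟩ : ∃ b : ℕ, ∀ i ∈ p.support, i < (b : ℤ) := by
    refine ⟨p.support.sup (fun i => i.toNat + 1), fun i hi => ?_⟩
    have : i.toNat + 1 ≤ p.support.sup (fun i => i.toNat + 1) :=
      Finset.le_sup (f := fun i : ℤ => i.toNat + 1) hi
    omega
  refine key b p fun i hi => ?_
  rcases hi with hi | hi
  · exact hp i hi
  · by_contra h
    have h4 := hb i (Finsupp.mem_support_iff.mpr h)
    have : (b : ℤ) * 1 ≤ b * c := by
      apply mul_le_mul_of_nonneg_left <;> omega
    omega
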